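/- arXiv:1011.3448 — 7 statements merged into one kernel-verified Lean document; each statement's English description precedes it below -/
import Mathlib

section
/- The ring of PGL₂-invariants of ℤ[A₁,B₁,C₁,A₂,B₂,C₂] is exactly the ℤ-subalgebra generated by Δ₁, Δ₂, Γ and Λ; that is, p ∈ ℤ[A₁,B₁,C₁,A₂,B₂,C₂] is a PGL₂-invariant if and only if p lies in the ℤ-subalgebra generated by Δ₁, Δ₂, Γ, Λ. -/
open MvPolynomial

noncomputable section

/- Variables in `MvPolynomial (Fin 6) ℤ`: `0 = A₁, 1 = B₁, 2 = C₁, 3 = A₂, 4 = B₂, 5 = C₂`.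
   Variables in `MvPolynomial (Fin 10) ℤ`: `0 = a, 1 = b, 2 = c, 3 = d`, and `4,…,9` are
   `A₁, B₁, C₁, A₂, B₂, C₂`. -/

/-- The inclusion `ℤ[A₁,…,C₂] → ℤ[a,b,c,d][A₁,…,C₂]`. -/
def emb : MvPolynomial (Fin 6) ℤ →ₐ[ℤ] MvPolynomial (Fin 10) ℤ :=
  aeval fun i => X ⟨i.val + 4, by omega⟩

def va : MvPolynomial (Fin 10) ℤ := X 0
def vb : MvPolynomial (Fin 10) ℤ := X 1
def vc : MvPolynomial (Fin 10) ℤ := X 2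
def vd : MvPolynomial (Fin 10) ℤ := X 3
def wA1 : MvPolynomial (Fin 10) ℤ := X 4
def wB1 : MvPolynomial (Fin 10) ℤ := X 5
def wC1 : MvPolynomial (Fin 10) ℤ := X 6
def wA2 : MvPolynomial (Fin 10) ℤ := X 7
def wB2 : MvPolynomial (Fin 10) ℤ := X 8
def wC2 : MvPolynomial (Fin 10) ℤ := X 9

/-- The coefficient-substitution homomorphism `σ` encoding the `PGL₂`-action:
`Aᵢ ↦ Aᵢa² + Bᵢac + Cᵢc²`, `Bᵢ ↦ 2Aᵢab + Bᵢ(ad+bc) + 2Cᵢcd`, `Cᵢ ↦ Aᵢb² + Bᵢbd + Cᵢd²`. -/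
def σPGL : MvPolynomial (Fin 6) ℤ →ₐ[ℤ] MvPolynomial (Fin 10) ℤ :=
  aeval ![wA1 * va ^ 2 + wB1 * va * vc + wC1 * vc ^ 2,
          2 * wA1 * va * vb + wB1 * (va * vd + vb * vc) + 2 * wC1 * vc * vd,
          wA1 * vb ^ 2 + wB1 * vb * vd + wC1 * vd ^ 2,
          wA2 * va ^ 2 + wB2 * va * vc + wC2 * vc ^ 2,
          2 * wA2 * va * vb + wB2 * (va * vd + vb * vc) + 2 * wC2 * vc * vd,
          wA2 * vb ^ 2 + wB2 * vb * vd + wC2 * vd ^ 2]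

/-- `p` is a `PGL₂`-invariant: each homogeneous component of degree `n` satisfies
`σ(p) = (ad - bc)ⁿ · p`. -/
def IsPGLInvariant (p : MvPolynomial (Fin 6) ℤ) : Prop :=
  ∀ n : ℕ, σPGL (homogeneousComponent n p) =
    (va * vd - vb * vc) ^ n * emb (homogeneousComponent n p)

def Δ₁ : MvPolynomial (Fin 6) ℤ := X 1 ^ 2 - 4 * X 0 * X 2
def Δ₂ : MvPolynomial (Fin 6) ℤ := X 4 ^ 2 - 4 * X 3 * X 5
def Γinv : MvPolynomial (Fin 6) ℤ := X 1 * X 4 - 2 * X 0 * X 5 - 2 * X 2 * X 3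
def Λinv : MvPolynomial (Fin 6) ℤ :=
  (X 0 * X 5 + X 2 * X 3) ^ 2 - (X 0 * X 5 + X 2 * X 3) * (X 1 * X 4)
    + X 0 * X 2 * (X 4 ^ 2 - 2 * X 3 * X 5) + X 3 * X 5 * (X 1 ^ 2 - 2 * X 0 * X 2)

def W (n : ℕ) : Submodule ℤ (MvPolynomial (Fin 6) ℤ) :=
  LinearMap.ker (σPGL.toLinearMap -
    (LinearMap.mulLeft ℤ ((va * vd - vb * vc) ^ n)).comp emb.toLinearMap)

theorem mem_W (n : ℕ) (p) : p ∈ W n ↔ σPGL p = (va * vd - vb * vc) ^ n * emb p := by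
  simp [W, LinearMap.mem_ker, sub_eq_zero]

abbrev S : Subalgebra ℤ (MvPolynomial (Fin 6) ℤ) := Algebra.adjoin ℤ {Δ₁, Δ₂, Γinv, Λinv}

theorem W_mul {m n p q} (hp : p ∈ W m) (hq : q ∈ W n) : p * q ∈ W (m + n) := by
  rw [mem_W] at *
  rw [map_mul, map_mul, hp, hq]; ring

theorem W_one : (1 : MvPolynomial (Fin 6) ℤ) ∈ W 0 := by
  rw [mem_W]; simp

theorem W_pow {m p} (hp : p ∈ W m) (k : ℕ) : p ^ k ∈ W (k * m) := by
  rw [mem_W] at *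
  rw [map_pow, map_pow, hp, mul_pow, ← pow_mul, mul_comm m]

theorem emb_X (i : Fin 6) : emb (X i) = X ⟨i.val + 4, by omega⟩ := by simp [emb]

theorem W_D1 : Δ₁ ∈ W 2 := by
  rw [mem_W]
  simp only [Δ₁, map_sub, map_mul, map_pow, map_add, map_ofNat]
  simp [σPGL, emb, va, vb, vc, vd, wA1, wB1, wC1, wA2, wB2, wC2]
  ring

theorem W_D2 : Δ₂ ∈ W 2 := by
  rw [mem_W]
  simp only [Δ₂, map_sub, map_mul, map_pow, map_add, map_ofNat]
  simp [σPGL, emb, va, vb, vc, vd, wA1, wB1, wC1, wA2, wB2, wC2]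
  ring

theorem W_G : Γinv ∈ W 2 := by
  rw [mem_W]
  simp only [Γinv, map_sub, map_mul, map_pow, map_add, map_ofNat]
  simp [σPGL, emb, va, vb, vc, vd, wA1, wB1, wC1, wA2, wB2, wC2]
  ring

theorem W_L : Λinv ∈ W 4 := by
  rw [mem_W]
  simp only [Λinv, map_sub, map_mul, map_pow, map_add, map_ofNat]
  simp [σPGL, emb, va, vb, vc, vd, wA1, wB1, wC1, wA2, wB2, wC2]
  ring

theorem hX (i : Fin 6) : (X i : MvPolynomial (Fin 6) ℤ).IsHomogeneous 1 := isHomogeneous_X _ _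

theorem hN (m : ℕ) [m.AtLeastTwo] :
    (OfNat.ofNat m : MvPolynomial (Fin 6) ℤ).IsHomogeneous 0 := by
  have := isHomogeneous_C (Fin 6) (OfNat.ofNat m : ℤ)
  simpa using this

theorem hom_D1 : Δ₁.IsHomogeneous 2 :=
  ((hX 1).pow 2).sub (((hN 4).mul (hX 0)).mul (hX 2))

theorem hom_D2 : Δ₂.IsHomogeneous 2 :=
  ((hX 4).pow 2).sub (((hN 4).mul (hX 3)).mul (hX 5))

theorem hom_G : Γinv.IsHomogeneous 2 :=
  (((hX 1).mul (hX 4)).sub (((hN 2).mul (hX 0)).mul (hX 5))).sub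
    (((hN 2).mul (hX 2)).mul (hX 3))

theorem hom_L : Λinv.IsHomogeneous 4 := by
  have h1 := ((hX 0).mul (hX 5)).add ((hX 2).mul (hX 3))
  have h2 := (h1.pow 2).sub (h1.mul ((hX 1).mul (hX 4)))
  have h3 := ((hX 0).mul (hX 2)).mul (((hX 4).pow 2).sub (((hN 2).mul (hX 3)).mul (hX 5)))
  have h4 := ((hX 3).mul (hX 5)).mul (((hX 1).pow 2).sub (((hN 2).mul (hX 0)).mul (hX 2)))
  exact (h2.add h3).add h4

theorem inv_of_mem (p) (hp : p ∈ S) : IsPGLInvariant p := by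
  have key : ∀ q ∈ Submonoid.closure ({Δ₁, Δ₂, Γinv, Λinv} : Set (MvPolynomial (Fin 6) ℤ)),
      ∃ n, q.IsHomogeneous n ∧ q ∈ W n := by
    intro q hq
    induction hq using Submonoid.closure_induction with
    | mem x hx =>
      rcases hx with rfl | rfl | rfl | rfl
      · exact ⟨2, hom_D1, W_D1⟩
      · exact ⟨2, hom_D2, W_D2⟩
      · exact ⟨2, hom_G, W_G⟩
      · exact ⟨4, hom_L, W_L⟩
    | one => exact ⟨0, isHomogeneous_one _ _, W_one⟩
    | mul x y _ _ hx hy =>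
      obtain ⟨m, h1, h2⟩ := hx
      obtain ⟨n, h3, h4⟩ := hy
      exact ⟨m + n, h1.mul h3, W_mul h2 h4⟩
  intro m
  rw [← mem_W]
  rw [← Subalgebra.mem_toSubmodule, Algebra.adjoin_eq_span] at hp
  induction hp using Submodule.span_induction with
  | mem x hx =>
    obtain ⟨n, h1, h2⟩ := key x hx
    rw [homogeneousComponent_of_mem ((mem_homogeneousSubmodule n x).2 h1)]
    split_ifs with h
    · rw [h]; exact h2
    · exact zero_mem _
  | zero => rw [map_zero]; exact zero_mem _
  | add x y _ _ hx hy => rw [map_add]; exact add_mem hx hy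
  | smul a x _ hx => rw [map_smul]; exact Submodule.smul_mem _ _ hx

def act {K : Type} [CommRing K] (a b c d : K) (x : Fin 6 → K) : Fin 6 → K :=
  ![x 0 * a ^ 2 + x 1 * a * c + x 2 * c ^ 2,
    2 * x 0 * a * b + x 1 * (a * d + b * c) + 2 * x 2 * c * d,
    x 0 * b ^ 2 + x 1 * b * d + x 2 * d ^ 2,
    x 3 * a ^ 2 + x 4 * a * c + x 5 * c ^ 2,
    2 * x 3 * a * b + x 4 * (a * d + b * c) + 2 * x 5 * c * d,
    x 3 * b ^ 2 + x 4 * b * d + x 5 * d ^ 2]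

theorem act_eq {K : Type} [CommRing K] [Algebra ℤ K] (a b c d : K) (x : Fin 6 → K) {n p} (hp : p ∈ W n) :
    aeval (act a b c d x) p = (a * d - b * c) ^ n * aeval x p := by
  rw [mem_W] at hp
  let ev : MvPolynomial (Fin 10) ℤ →ₐ[ℤ] K :=
    aeval ![a, b, c, d, x 0, x 1, x 2, x 3, x 4, x 5]
  have h1 : (ev.comp σPGL) = aeval (act a b c d x) := by
    ext i
    fin_cases i <;>
    simp [ev, σPGL, act, va, vb, vc, vd, wA1, wB1, wC1, wA2, wB2, wC2]
  have h2 : (ev.comp emb) = aeval x := by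
    ext i
    fin_cases i <;> simp [ev, emb]
  have h := congrArg ev hp
  rw [map_mul, ← AlgHom.comp_apply, ← AlgHom.comp_apply, h1, h2] at h
  rw [h]
  simp [ev, va, vb, vc, vd]

theorem zero_of_C {k : ℕ} (p : MvPolynomial (Fin k) ℤ)
    (h : ∀ x : Fin k → ℂ, aeval x p = 0) : p = 0 := by
  apply map_injective (Int.castRingHom ℂ) Int.cast_injective
  apply MvPolynomial.funext
  intro x
  rw [eval_map, map_zero, map_zero, ← h x, aeval_def]
  rfl

def φ : MvPolynomial (Fin 6) ℤ →ₐ[ℤ] MvPolynomial (Fin 6) ℤ :=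
  aeval ![0, X 1, 0, X 3, X 4, X 5]

theorem aeval_slice {K : Type} [CommRing K] [Algebra ℤ K] (x : Fin 6 → K) (h0 : x 0 = 0) (h2 : x 2 = 0) (p) :
    aeval x (φ p) = aeval x p := by
  have : (aeval x).comp φ = (aeval x : MvPolynomial (Fin 6) ℤ →ₐ[ℤ] K) := by
    ext i
    fin_cases i <;> simp [φ, h0, h2]
  exact DFunLike.congr_fun this p

theorem D1_ne : Δ₁ ≠ 0 := by
  intro h
  have := congrArg (aeval (![0, 1, 0, 0, 0, 0] : Fin 6 → ℤ)) h
  simp [Δ₁] at this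

theorem zero_of_slice {n p} (hp : p ∈ W n) (h : φ p = 0) : p = 0 := by
  have : X 0 * Δ₁ * p = 0 := by
    apply zero_of_C
    intro x
    rw [map_mul, map_mul, aeval_X]
    by_cases hA : x 0 = 0
    · simp [hA]
    obtain ⟨s, hs⟩ := IsAlgClosed.exists_pow_nat_eq (x 1 ^ 2 - 4 * x 0 * x 2) (n := 2) (by norm_num)
    by_cases hs0 : s = 0
    · have : aeval x Δ₁ = (0 : ℂ) := by
        simp [Δ₁, ← hs, hs0]
      simp [this]
    have e := act_eq (-x 1 + s) (-x 1 - s) (2 * x 0) (2 * x 0) x hp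
    rw [← aeval_slice, h, map_zero] at e
    · have : ((-x 1 + s) * (2 * x 0) - (-x 1 - s) * (2 * x 0)) = 4 * x 0 * s := by ring
      rw [this] at e
      have h3 : (4 * x 0 * s) ^ n ≠ 0 := by
        apply pow_ne_zero
        simp [hA, hs0]
      rw [(mul_eq_zero.1 e.symm).resolve_left h3, mul_zero]
    · simp only [act, Matrix.cons_val]
      linear_combination (x 0) * hs
    · simp only [act, Matrix.cons_val]
      linear_combination (x 0) * hs
  rcases mul_eq_zero.1 this with h | h
  · exact absurd h (mul_ne_zero (X_ne_zero _) D1_ne)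
  · exact h

theorem aeval_scale_coeff (c : Fin 6 → ℤ) (p : MvPolynomial (Fin 6) ℤ) (e) :
    coeff e (aeval (fun i => C (c i) * X i : Fin 6 → MvPolynomial (Fin 6) ℤ) p)
      = (∏ i, c i ^ e i) * coeff e p := by
  induction p using MvPolynomial.induction_on' with
  | add p q hp hq => rw [map_add, coeff_add, coeff_add, hp, hq]; ring
  | monomial u a =>
    have : aeval (fun i => C (c i) * X i : Fin 6 → MvPolynomial (Fin 6) ℤ) (monomial u a)
        = C (∏ i, c i ^ u i) * monomial u a := by
      rw [aeval_monomial, monomial_eq, Finsupp.prod_fintype _ _ (by simp),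
        Finsupp.prod_fintype _ _ (by simp)]
      simp only [mul_pow, Finset.prod_mul_distrib, map_prod, map_pow]
      simp
      ring
    rw [this, coeff_C_mul, coeff_monomial]
    split_ifs with h
    · rw [h]
    · simp

theorem torus {n p} (hp : p ∈ W n) (hh : p.IsHomogeneous n) (e) (he : e ∈ p.support) :
    e 0 + e 1 + e 2 + e 3 + e 4 + e 5 = n ∧ e 0 + e 3 = e 2 + e 5 := by
  rw [mem_support_iff] at he
  have h1 : e 0 + e 1 + e 2 + e 3 + e 4 + e 5 = n := by
    have := hh he
    rw [← this]
    simp [Finsupp.weight_apply, Finsupp.sum_fintype, Fin.sum_univ_succ]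
    ring
  refine ⟨h1, ?_⟩
  have h2 := act_eq (2 : MvPolynomial (Fin 6) ℤ) 0 0 1 X hp
  have h3 : act (2 : MvPolynomial (Fin 6) ℤ) 0 0 1 X
      = fun i => C ((![4, 2, 1, 4, 2, 1] : Fin 6 → ℤ) i) * X i := by
    funext i
    fin_cases i <;> simp [act] <;> ring
  rw [h3] at h2
  have h4 := congrArg (coeff e) h2
  rw [aeval_scale_coeff] at h4
  have h5 : ((2 : MvPolynomial (Fin 6) ℤ) * 1 - 0 * 0) ^ n = C (2 ^ n) := by simp
  rw [h5, coeff_C_mul, aeval_X_left_apply] at h4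
  have h6 := mul_right_cancel₀ he h4
  have h7 : ∏ i, (![4, 2, 1, 4, 2, 1] : Fin 6 → ℤ) i ^ e i
      = 2 ^ (2 * e 0 + e 1 + 2 * e 3 + e 4) := by
    simp [Fin.prod_univ_succ, pow_add, pow_mul]
    ring
  rw [h7] at h6
  have h8 := Int.pow_right_injective (a := 2) (by norm_num) h6
  omega

theorem mono_eq (e : Fin 6 →₀ ℕ) (a : ℤ) : monomial e a =
    a • (X 0 ^ e 0 * X 1 ^ e 1 * X 2 ^ e 2 * X 3 ^ e 3 * X 4 ^ e 4 * X 5 ^ e 5 :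
      MvPolynomial (Fin 6) ℤ) := by
  rw [monomial_eq, Finsupp.prod_fintype _ _ (by simp), smul_eq_C_mul]
  simp [Fin.prod_univ_succ]
  left
  ring

theorem φ_mono (e : Fin 6 →₀ ℕ) (a : ℤ) : φ (monomial e a) =
    a • (0 ^ e 0 * X 1 ^ e 1 * 0 ^ e 2 * X 3 ^ e 3 * X 4 ^ e 4 * X 5 ^ e 5 :
      MvPolynomial (Fin 6) ℤ) := by
  rw [mono_eq, map_smul]
  simp [φ]

theorem ψ_mono (e : Fin 6 →₀ ℕ) (a : ℤ) :
    aeval (![0, X 1, 0, X 5, X 4, X 3] : Fin 6 → MvPolynomial (Fin 6) ℤ) (monomial e a) =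
    a • (0 ^ e 0 * X 1 ^ e 1 * 0 ^ e 2 * X 5 ^ e 3 * X 4 ^ e 4 * X 3 ^ e 5 :
      MvPolynomial (Fin 6) ℤ) := by
  rw [mono_eq, map_smul]
  simp

theorem odd_case {n p} (hp : p ∈ W n) (hh : p.IsHomogeneous n) (hn : Odd n) : p = 0 := by
  apply zero_of_slice hp
  have h2 := act_eq (0 : MvPolynomial (Fin 6) ℤ) 1 1 0 ![0, X 1, 0, X 3, X 4, X 5] hp
  have h3 : act (0 : MvPolynomial (Fin 6) ℤ) 1 1 0 ![0, X 1, 0, X 3, X 4, X 5]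
      = ![0, X 1, 0, X 5, X 4, X 3] := by
    funext i
    fin_cases i <;> simp [act]
  rw [h3] at h2
  have h4 : aeval (![0, X 1, 0, X 5, X 4, X 3] : Fin 6 → MvPolynomial (Fin 6) ℤ) p = φ p := by
    rw [p.as_sum, map_sum, map_sum]
    apply Finset.sum_congr rfl
    intro e he
    obtain ⟨_, h⟩ := torus hp hh e he
    rw [φ_mono, ψ_mono]
    refine congrArg (fun q => (coeff e p) • q) ?_
    by_cases h0 : e 0 = 0
    · by_cases h2 : e 2 = 0
      · have : e 3 = e 5 := by omega
        rw [this, h0, h2]; ring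
      · simp [h2]
    · simp [h0]
  have h5 : aeval (![0, X 1, 0, X 3, X 4, X 5] : Fin 6 → MvPolynomial (Fin 6) ℤ) p = φ p := rfl
  rw [h4, h5] at h2
  simp [hn.neg_one_pow] at h2
  exact self_eq_neg.1 h2

theorem D1_mem : Δ₁ ∈ S := Algebra.subset_adjoin (by simp)
theorem D2_mem : Δ₂ ∈ S := Algebra.subset_adjoin (by simp)
theorem G_mem : Γinv ∈ S := Algebra.subset_adjoin (by simp)
theorem L_mem : Λinv ∈ S := Algebra.subset_adjoin (by simp)

theorem φ_D1 : φ Δ₁ = X 1 ^ 2 := by simp [φ, Δ₁]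
theorem φ_G : φ Γinv = X 1 * X 4 := by simp [φ, Γinv]
theorem φ_L : φ Λinv = X 3 * X 5 * X 1 ^ 2 := by simp [φ, Λinv]

theorem even_case {n p} (hp : p ∈ W n) (hh : p.IsHomogeneous n) (hn : Even n) :
    Δ₁ ^ n * p ∈ S := by
  have key : φ (Δ₁ ^ n * p) ∈
      (S.toSubmodule ⊓ W (n * 2 + n)).map φ.toLinearMap := by
    rw [map_mul, map_pow, φ_D1]
    rw [congrArg φ p.as_sum, map_sum, Finset.mul_sum]
    apply sum_mem
    intro e he
    obtain ⟨h1, h⟩ := torus hp hh e he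
    rw [φ_mono, mul_smul_comm]
    apply Submodule.smul_mem
    by_cases h0 : e 0 = 0
    swap
    · simp [h0]
    by_cases h2 : e 2 = 0
    swap
    · simp [h2]
    have h35 : e 5 = e 3 := by omega
    obtain ⟨m, hm⟩ := hn
    obtain ⟨l, hl⟩ : ∃ l, n * 2 + e 1 = e 4 + 2 * e 3 + 2 * l :=
      ⟨n + m - e 4 - 2 * e 3, by omega⟩
    refine ⟨Γinv ^ e 4 * Λinv ^ e 3 * Δ₁ ^ l, ⟨?_, ?_⟩, ?_⟩
    · rw [SetLike.mem_coe, Subalgebra.mem_toSubmodule]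
      exact mul_mem (mul_mem (pow_mem G_mem _) (pow_mem L_mem _)) (pow_mem D1_mem _)
    · have := W_mul (W_mul (W_pow W_G (e 4)) (W_pow W_L (e 3))) (W_pow W_D1 l)
      have e0 : n * 2 + n = e 4 * 2 + e 3 * 4 + l * 2 := by omega
      rw [← e0] at this
      exact this
    · simp only [AlgHom.toLinearMap_apply, map_mul, map_pow, φ_D1, φ_G, φ_L]
      rw [h0, h2, h35]
      have : (X 1 ^ 2) ^ n * (0 ^ 0 * X 1 ^ e 1 * 0 ^ 0 * X 3 ^ e 3 * X 4 ^ e 4 * X 5 ^ e 3)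
        = (X 1 ^ (n * 2 + e 1) * X 3 ^ e 3 * X 4 ^ e 4 * X 5 ^ e 3 :
            MvPolynomial (Fin 6) ℤ) := by ring
      rw [this, hl]
      ring
  obtain ⟨s, ⟨hs, hw⟩, hq⟩ := key
  have h1 : s - Δ₁ ^ n * p ∈ W (n * 2 + n) := sub_mem hw (W_mul (W_pow W_D1 n) hp)
  have h2 := zero_of_slice h1 (by
    rw [map_sub, sub_eq_zero]; exact hq)
  rw [← sub_eq_zero.1 h2]
  exact hs

def ev3 : MvPolynomial (Fin 3) ℤ →ₐ[ℤ] MvPolynomial (Fin 6) ℤ := aeval ![Δ₁, Δ₂, Λinv]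

theorem G_sq : Γinv ^ 2 = Δ₁ * Δ₂ + 4 * Λinv := by
  simp only [Γinv, Δ₁, Δ₂, Λinv]; ring

theorem normal_form (p) (hp : p ∈ S) : ∃ f g, p = ev3 f + Γinv * ev3 g := by
  induction hp using Algebra.adjoin_induction with
  | mem x hx =>
    rcases hx with rfl | rfl | rfl | rfl
    · exact ⟨X 0, 0, by simp [ev3]⟩
    · exact ⟨X 1, 0, by simp [ev3]⟩
    · exact ⟨0, 1, by simp⟩
    · exact ⟨X 2, 0, by simp [ev3]⟩
  | algebraMap r => exact ⟨C r, 0, by simp [ev3]⟩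
  | add x y _ _ hx hy =>
    obtain ⟨f, g, rfl⟩ := hx
    obtain ⟨f', g', rfl⟩ := hy
    exact ⟨f + f', g + g', by simp only [map_add]; ring⟩
  | mul x y _ _ hx hy =>
    obtain ⟨f, g, rfl⟩ := hx
    obtain ⟨f', g', rfl⟩ := hy
    refine ⟨f * f' + (X 0 * X 1 + 4 * X 2) * g * g', f * g' + g * f', ?_⟩
    have : ev3 (X 0 * X 1 + 4 * X 2) = Γinv ^ 2 := by
      rw [G_sq, map_add, map_mul, map_mul, map_ofNat]; simp [ev3]
    simp only [map_add ev3 (f * f'), map_add ev3 (f * g'), map_mul ev3 _ g', map_mul ev3 _ g,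
      map_mul ev3 _ f', this]
    ring

theorem ev3_mem (f) : ev3 f ∈ S := by
  induction f using MvPolynomial.induction_on with
  | C a => simpa [ev3] using S.algebraMap_mem a
  | add p q hp hq => rw [map_add]; exact add_mem hp hq
  | mul_X p i hp =>
    rw [map_mul]
    refine mul_mem hp ?_
    fin_cases i
    · simpa [ev3] using D1_mem
    · simpa [ev3] using D2_mem
    · simpa [ev3] using L_mem

theorem split0 (f : MvPolynomial (Fin 3) ℤ) :
    ∃ f', f = X 0 * f' + aeval (![0, X 1, X 2] : Fin 3 → MvPolynomial (Fin 3) ℤ) f := by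
  induction f using MvPolynomial.induction_on with
  | C a => exact ⟨0, by simp⟩
  | add p q hp hq =>
    obtain ⟨p', hp⟩ := hp
    obtain ⟨q', hq⟩ := hq
    refine ⟨p' + q', ?_⟩
    rw [map_add]
    linear_combination hp + hq
  | mul_X p i hp =>
    obtain ⟨p', hp⟩ := hp
    fin_cases i
    · exact ⟨p, by simp [mul_comm]⟩
    · refine ⟨p' * X 1, ?_⟩
      have e : aeval (![0, X 1, X 2] : Fin 3 → MvPolynomial (Fin 3) ℤ) (X 1 : MvPolynomial (Fin 3) ℤ) = X 1 := by
        simp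
      have := congrArg (· * (X 1 : MvPolynomial (Fin 3) ℤ)) hp
      rw [map_mul]
      refine this.trans ?_
      change _ = _ + _ * aeval (![0, X 1, X 2] : Fin 3 → MvPolynomial (Fin 3) ℤ) (X 1 : MvPolynomial (Fin 3) ℤ)
      rw [e]
      ring
    · refine ⟨p' * X 2, ?_⟩
      have e : aeval (![0, X 1, X 2] : Fin 3 → MvPolynomial (Fin 3) ℤ) (X 2 : MvPolynomial (Fin 3) ℤ) = X 2 := by
        simp
      have := congrArg (· * (X 2 : MvPolynomial (Fin 3) ℤ)) hp
      rw [map_mul]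
      refine this.trans ?_
      change _ = _ + _ * aeval (![0, X 1, X 2] : Fin 3 → MvPolynomial (Fin 3) ℤ) (X 2 : MvPolynomial (Fin 3) ℤ)
      rw [e]
      ring

theorem div_D1 (p) (hp : Δ₁ * p ∈ S) : p ∈ S := by
  obtain ⟨f, g, h⟩ := normal_form _ hp
  obtain ⟨f', hf⟩ := split0 f
  obtain ⟨g', hg⟩ := split0 g
  have e1 : ∀ x y : ℂ, aeval ![0, y ^ 2, x ^ 2] f - 2 * x * aeval ![0, y ^ 2, x ^ 2] g = 0 := by
    intro x y
    have h3 : (aeval (![0, 0, 1, x, y, 0] : Fin 6 → ℂ)).comp ev3 = aeval ![0, y ^ 2, x ^ 2] := by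
      ext i
      fin_cases i <;> simp [ev3, Δ₁, Δ₂, Λinv]
    have h2 := congrArg (aeval (![0, 0, 1, x, y, 0] : Fin 6 → ℂ)) h
    rw [map_mul, map_add, map_mul, ← AlgHom.comp_apply, ← AlgHom.comp_apply, h3] at h2
    simp [Δ₁, Γinv] at h2
    linear_combination -h2
  have e2 : ∀ u v : ℂ, aeval ![0, u, v] f = 0 ∧ v * aeval ![0, u, v] g = 0 := by
    intro u v
    obtain ⟨y, rfl⟩ := IsAlgClosed.exists_pow_nat_eq u (n := 2) (by norm_num)
    obtain ⟨x, rfl⟩ := IsAlgClosed.exists_pow_nat_eq v (n := 2) (by norm_num)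
    have a1 := e1 x y
    have a2 := e1 (-x) y
    rw [neg_sq] at a2
    constructor
    · linear_combination (a1 + a2) / 2
    · linear_combination x * (a2 - a1) / 4
  have e3 : ∀ (x : Fin 3 → ℂ) (f : MvPolynomial (Fin 3) ℤ),
      aeval x (aeval (![0, X 1, X 2] : Fin 3 → MvPolynomial (Fin 3) ℤ) f)
        = aeval ![0, x 1, x 2] f := by
    intro x f
    rw [← AlgHom.comp_apply]
    congr 1
    ext i
    fin_cases i <;> simp
  have f0 : aeval (![0, X 1, X 2] : Fin 3 → MvPolynomial (Fin 3) ℤ) f = 0 := by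
    apply zero_of_C
    intro x
    rw [e3]
    exact (e2 _ _).1
  have g0 : X 2 * aeval (![0, X 1, X 2] : Fin 3 → MvPolynomial (Fin 3) ℤ) g = 0 := by
    apply zero_of_C
    intro x
    rw [map_mul, e3, aeval_X]
    exact (e2 _ _).2
  have g0 := (mul_eq_zero.1 g0).resolve_left (X_ne_zero _)
  rw [f0, add_zero] at hf
  rw [g0, add_zero] at hg
  have x0 : ev3 (X 0) = Δ₁ := by simp [ev3]
  rw [hf, hg, map_mul, map_mul, x0] at h
  have : p = ev3 f' + Γinv * ev3 g' := by
    apply mul_left_cancel₀ D1_ne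
    linear_combination h
  rw [this]
  exact add_mem (ev3_mem _) (mul_mem G_mem (ev3_mem _))

theorem div_D1_pow (n : ℕ) (p) (hp : Δ₁ ^ n * p ∈ S) : p ∈ S := by
  induction n with
  | zero => simpa using hp
  | succ n ih =>
    apply ih
    apply div_D1
    convert hp using 1
    ring

/-- The ring of `PGL₂`-invariants of `ℤ[A₁,B₁,C₁,A₂,B₂,C₂]` is exactly the `ℤ`-subalgebra
generated by `Δ₁, Δ₂, Γ, Λ`. -/
theorem pgl2_invariants_eq_adjoin (p : MvPolynomial (Fin 6) ℤ) :
    IsPGLInvariant p ↔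
      p ∈ Algebra.adjoin ℤ ({Δ₁, Δ₂, Γinv, Λinv} : Set (MvPolynomial (Fin 6) ℤ)) := by
  refine ⟨fun h => ?_, inv_of_mem p⟩
  rw [← sum_homogeneousComponent p]
  apply sum_mem
  intro n _
  have hw := (mem_W n _).2 (h n)
  have hh := homogeneousComponent_isHomogeneous n p
  rcases Nat.even_or_odd n with hn | hn
  · exact div_D1_pow n _ (even_case hw hh hn)
  · rw [odd_case hw hh hn]
    exact zero_mem _
end
end

section
/- The kernel of the ℤ-algebra homomorphism ℤ[w,x,y,z] → ℤ[A₁,B₁,C₁,A₂,B₂,C₂] sending w ↦ Δ₁, x ↦ Δ₂, y ↦ Γ, z ↦ Λ is the principal ideal generated by 4z − y² + wx. Hence the ring of PGL₂-invariants is isomorphic to ℤ[Δ₁,Δ₂,Γ,Λ]/(4Λ − Γ² + Δ₁Δ₂). -/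
open MvPolynomial

noncomputable section

/-- The `ℤ`-algebra homomorphism `ℤ[w,x,y,z] → ℤ[A₁,…,C₂]`, `w ↦ Δ₁`, `x ↦ Δ₂`,
`y ↦ Γ`, `z ↦ Λ`. -/
def presentation : MvPolynomial (Fin 4) ℤ →ₐ[ℤ] MvPolynomial (Fin 6) ℤ :=
  aeval ![Δ₁, Δ₂, Γinv, Λinv]

/-- inclusion of `ℤ[w,x,z]` -/
def incl : MvPolynomial (Fin 3) ℤ →ₐ[ℤ] MvPolynomial (Fin 4) ℤ := aeval ![X 0, X 1, X 3]

theorem red_form (p : MvPolynomial (Fin 4) ℤ) :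
    ∃ (q : MvPolynomial (Fin 4) ℤ) (a b : MvPolynomial (Fin 3) ℤ),
      p = (4 * X 3 - X 2 ^ 2 + X 0 * X 1) * q + incl a + incl b * X 2 := by
  induction p using MvPolynomial.induction_on with
  | C n => exact ⟨0, C n, 0, by simp [incl]⟩
  | add p p' h h' =>
    obtain ⟨q, a, b, e⟩ := h
    obtain ⟨q', a', b', e'⟩ := h'
    refine ⟨q + q', a + a', b + b', ?_⟩
    rw [e, e', map_add, map_add]; ring
  | mul_X p i h =>
    obtain ⟨q, a, b, e⟩ := h
    have h0 : incl (X 0) = X 0 := by simp [incl]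
    have h1 : incl (X 1) = X 1 := by simp [incl]
    have h2 : incl (X 2) = X 3 := by simp [incl]
    fin_cases i
    · refine ⟨q * X 0, a * X 0, b * X 0, ?_⟩
      simp only [map_mul, h0, e]; simp only [Fin.zero_eta]; ring
    · refine ⟨q * X 1, a * X 1, b * X 1, ?_⟩
      simp only [map_mul, h1, e]; simp only [Fin.mk_one]; ring
    · refine ⟨q * X 2 - incl b, b * (4 * X 2 + X 0 * X 1), a, ?_⟩
      simp only [map_mul, map_add, map_ofNat, h0, h1, h2, e]; simp only [Fin.reduceFinMk]; ring
    · refine ⟨q * X 3, a * X 2, b * X 2, ?_⟩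
      simp only [map_mul, h2, e]; simp only [Fin.reduceFinMk]; ring

theorem gen_mem : presentation (4 * X 3 - X 2 ^ 2 + X 0 * X 1) = 0 := by
  simp only [presentation, map_add, map_sub, map_mul, map_pow, map_ofNat, aeval_X]
  simp [Δ₁, Δ₂, Γinv, Λinv]
  ring

theorem ker_eval (p : MvPolynomial (Fin 4) ℤ) (hp : presentation p = 0) (w x y z : ℂ)
    (h : y ^ 2 = 4 * z + w * x) : aeval ![w, x, y, z] p = 0 := by
  obtain ⟨β, hβ⟩ := IsAlgClosed.exists_pow_nat_eq w (n := 2) (by norm_num)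
  obtain ⟨δ, hδ⟩ := IsAlgClosed.exists_pow_nat_eq x (n := 2) (by norm_num)
  let v : Fin 6 → ℂ := ![0, β, 1, (β * δ - y) / 2, δ, 0]
  have key : (aeval v : MvPolynomial (Fin 6) ℤ →ₐ[ℤ] ℂ).comp presentation
      = aeval ![w, x, y, z] := by
    apply MvPolynomial.algHom_ext
    intro i
    fin_cases i
    · simp [presentation, Δ₁, v, hβ]
    · simp [presentation, Δ₂, v, hδ]
    · simp [presentation, Γinv, v]; ring
    · simp [presentation, Λinv, v]
      subst hβ hδ
      linear_combination h / 4
  rw [← key]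
  simp [hp]

theorem aeval_incl (w x z : ℤ) (y : ℂ) (a : MvPolynomial (Fin 3) ℤ) :
    aeval ![(w : ℂ), x, y, z] (incl a) = ((eval ![w, x, z] a : ℤ) : ℂ) := by
  have : (aeval ![(w : ℂ), x, y, z] : MvPolynomial (Fin 4) ℤ →ₐ[ℤ] ℂ).comp incl
      = (Algebra.ofId ℤ ℂ).comp (aeval ![w, x, z]) := by
    apply MvPolynomial.algHom_ext
    intro i
    fin_cases i <;> simp [incl, Algebra.ofId_apply]
  have := DFunLike.congr_fun this a
  simpa [Algebra.ofId_apply, coe_aeval_eq_eval] using this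

theorem red_zero (a b : MvPolynomial (Fin 3) ℤ)
    (h : presentation (incl a + incl b * X 2) = 0) : a = 0 ∧ b = 0 := by
  have key : ∀ w x z : ℤ, eval ![w, x, z] a = 0 ∧
      eval ![w, x, z] (b ^ 2 * (4 * X 2 + X 0 * X 1)) = 0 := by
    intro w x z
    obtain ⟨s, hs⟩ := IsAlgClosed.exists_pow_nat_eq (4 * (z : ℂ) + w * x) (n := 2) (by norm_num)
    have h1 := ker_eval _ h w x s z hs
    have h2 := ker_eval _ h w x (-s) z (by rw [neg_sq, hs])
    simp only [map_add, map_mul, aeval_incl, aeval_X] at h1 h2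
    simp at h1 h2
    constructor
    · have : ((eval ![w, x, z] a : ℤ) : ℂ) = 0 := by linear_combination (h1 + h2) / 2
      exact_mod_cast this
    · have h3 : ((eval ![w, x, z] b : ℤ) : ℂ) * s = 0 := by linear_combination (h1 - h2) / 2
      have : (((eval ![w, x, z] b) ^ 2 * (4 * z + w * x) : ℤ) : ℂ) = 0 := by
        push_cast
        rw [← hs]
        linear_combination ((eval ![w, x, z] b : ℤ) : ℂ) * s * h3
      simpa using (by exact_mod_cast this : (eval ![w, x, z] b) ^ 2 * (4 * z + w * x) = 0)
  have vec : ∀ v : Fin 3 → ℤ, v = ![v 0, v 1, v 2] := by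
    intro v; ext i; fin_cases i <;> rfl
  constructor
  · apply MvPolynomial.funext
    intro v
    rw [vec v, map_zero]
    exact (key _ _ _).1
  · have h0 : b ^ 2 * (4 * X 2 + X 0 * X 1) = 0 := by
      apply MvPolynomial.funext
      intro v
      rw [vec v, map_zero]
      exact (key _ _ _).2
    rcases mul_eq_zero.1 h0 with h0 | h0
    · exact pow_eq_zero_iff (two_ne_zero) |>.1 h0
    · have := congrArg (eval ![1, 1, 0]) h0
      simp at this

/-- The kernel of `w ↦ Δ₁, x ↦ Δ₂, y ↦ Γ, z ↦ Λ` is the principal ideal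
generated by `4z - y² + wx`; hence the ring of `PGL₂`-invariants is isomorphic to
`ℤ[Δ₁,Δ₂,Γ,Λ]/(4Λ - Γ² + Δ₁Δ₂)`. -/
theorem ker_presentation :
    RingHom.ker (presentation : MvPolynomial (Fin 4) ℤ →+* MvPolynomial (Fin 6) ℤ) =
      Ideal.span {4 * X 3 - X 2 ^ 2 + X 0 * X 1} := by
  ext p
  rw [RingHom.mem_ker, Ideal.mem_span_singleton]
  constructor
  · intro hp
    have hp : presentation p = 0 := hp
    obtain ⟨q, a, b, e⟩ := red_form p
    have h : presentation (incl a + incl b * X 2) = 0 := by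
      rw [e, add_assoc, map_add, map_mul, gen_mem, zero_mul, zero_add] at hp
      exact hp
    obtain ⟨rfl, rfl⟩ := red_zero a b h
    exact ⟨q, by rw [e]; simp⟩
  · rintro ⟨q, rfl⟩
    change presentation _ = 0
    rw [map_mul, gen_mem, zero_mul]
end
end

section
/- The fixed subalgebra of the polynomial ring ℤ[x,y,u] under the ℤ-algebra automorphism sending x ↦ −x, y ↦ −y, u ↦ u is exactly the ℤ-subalgebra generated by x², y², xy and u. -/
open MvPolynomial

noncomputable section

/- Variables in `MvPolynomial (Fin 3) ℤ`: `0 = x, 1 = y, 2 = u`. -/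

/-- The `ℤ`-algebra endomorphism `τ` of `ℤ[x,y,u]` with `x ↦ −x`, `y ↦ −y`, `u ↦ u`
(a `ℤ/2`-action). -/
def τ : MvPolynomial (Fin 3) ℤ →ₐ[ℤ] MvPolynomial (Fin 3) ℤ :=
  aeval ![-X 0, -X 1, X 2]

abbrev Aev : Subalgebra ℤ (MvPolynomial (Fin 3) ℤ) := Algebra.adjoin ℤ
        ({X 0 ^ 2, X 1 ^ 2, X 0 * X 1, X 2} : Set (MvPolynomial (Fin 3) ℤ))

lemma Aev_fixed (p : MvPolynomial (Fin 3) ℤ) (hp : p ∈ Aev) : τ p = p := by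
  have h : Aev ≤ AlgHom.equalizer τ (AlgHom.id ℤ _) := by
    refine Algebra.adjoin_le ?_
    rintro q (rfl | rfl | rfl | rfl) <;> simp [τ, AlgHom.mem_equalizer]
  exact h hp

lemma Aev_decomp (p : MvPolynomial (Fin 3) ℤ) :
    ∃ a ∈ Aev, ∃ b ∈ Aev, ∃ c ∈ Aev, p = a + X 0 * b + X 1 * c := by
  have hx : (X 0 ^ 2 : MvPolynomial (Fin 3) ℤ) ∈ Aev := Algebra.subset_adjoin (by simp)
  have hy : (X 1 ^ 2 : MvPolynomial (Fin 3) ℤ) ∈ Aev := Algebra.subset_adjoin (by simp)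
  have hxy : (X 0 * X 1 : MvPolynomial (Fin 3) ℤ) ∈ Aev := Algebra.subset_adjoin (by simp)
  have hu : (X 2 : MvPolynomial (Fin 3) ℤ) ∈ Aev := Algebra.subset_adjoin (by simp)
  induction p using MvPolynomial.induction_on with
  | C n => exact ⟨C n, Aev.algebraMap_mem n, 0, zero_mem _, 0, zero_mem _, by simp⟩
  | add p q hp hq =>
    obtain ⟨a, ha, b, hb, c, hc, rfl⟩ := hp
    obtain ⟨a', ha', b', hb', c', hc', rfl⟩ := hq
    exact ⟨a + a', add_mem ha ha', b + b', add_mem hb hb', c + c', add_mem hc hc', by ring⟩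
  | mul_X p i hp =>
    obtain ⟨a, ha, b, hb, c, hc, rfl⟩ := hp
    fin_cases i
    · exact ⟨X 0 ^ 2 * b + X 0 * X 1 * c, add_mem (mul_mem hx hb) (mul_mem hxy hc),
        a, ha, 0, zero_mem _, by simp only [Fin.zero_eta]; ring⟩
    · exact ⟨X 0 * X 1 * b + X 1 ^ 2 * c, add_mem (mul_mem hxy hb) (mul_mem hy hc),
        0, zero_mem _, a, ha, by simp only [Fin.mk_one]; ring⟩
    · exact ⟨X 2 * a, mul_mem hu ha, X 2 * b, mul_mem hu hb, X 2 * c, mul_mem hu hc,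
        by simp only [Fin.reduceFinMk]; ring⟩

/-- The fixed subalgebra of `ℤ[x,y,u]` under `x ↦ −x`, `y ↦ −y`, `u ↦ u` is exactly the
`ℤ`-subalgebra generated by `x²`, `y²`, `xy` and `u`. -/
theorem fixed_points_sign_action (p : MvPolynomial (Fin 3) ℤ) :
    τ p = p ↔
      p ∈ Algebra.adjoin ℤ
        ({X 0 ^ 2, X 1 ^ 2, X 0 * X 1, X 2} : Set (MvPolynomial (Fin 3) ℤ)) := by
  refine ⟨fun h => ?_, Aev_fixed p⟩
  obtain ⟨a, ha, b, hb, c, hc, rfl⟩ := Aev_decomp p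
  have h0 : τ (X 0) = -X 0 := by simp [τ]
  have h1 : τ (X 1) = -X 1 := by simp [τ]
  rw [map_add, map_add, map_mul, map_mul, h0, h1, Aev_fixed a ha, Aev_fixed b hb,
    Aev_fixed c hc] at h
  have h2 : (2 : MvPolynomial (Fin 3) ℤ) * (X 0 * b + X 1 * c) = 0 := by
    linear_combination -h
  have h3 : X 0 * b + X 1 * c = 0 := (mul_eq_zero.mp h2).resolve_left two_ne_zero
  rw [add_assoc, h3, add_zero]
  exact ha
end
end

section
/- The kernel of the ℤ-algebra homomorphism ℤ[w,x,y,z] → ℤ[b₁,b₂,u] defined by w ↦ b₁², x ↦ b₂², y ↦ 2u − b₁b₂, z ↦ u² − b₁b₂u is the principal ideal generated by y² − 4z − wx. -/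
open MvPolynomial

noncomputable section

/- Variables in `MvPolynomial (Fin 4) ℤ`: `0 = w, 1 = x, 2 = y, 3 = z`.
   Variables in `MvPolynomial (Fin 3) ℤ`: `0 = b₁, 1 = b₂, 2 = u`. -/

/-- The `ℤ`-algebra homomorphism `ℤ[w,x,y,z] → ℤ[b₁,b₂,u]` with `w ↦ b₁²`, `x ↦ b₂²`,
`y ↦ 2u − b₁b₂`, `z ↦ u² − b₁b₂u`. -/
def ψ : MvPolynomial (Fin 4) ℤ →ₐ[ℤ] MvPolynomial (Fin 3) ℤ :=
  aeval ![X 0 ^ 2, X 1 ^ 2, 2 * X 2 - X 0 * X 1, X 2 ^ 2 - X 0 * X 1 * X 2]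

def emb3 : MvPolynomial (Fin 3) ℤ →ₐ[ℤ] MvPolynomial (Fin 4) ℤ :=
  aeval ![X 0, X 1, X 3]

lemma reduce_mod (p : MvPolynomial (Fin 4) ℤ) :
    ∃ (A B : MvPolynomial (Fin 3) ℤ) (q : MvPolynomial (Fin 4) ℤ),
      p = emb3 A + X 2 * emb3 B + q * (X 2 ^ 2 - 4 * X 3 - X 0 * X 1) := by
  induction p using MvPolynomial.induction_on with
  | C a => exact ⟨C a, 0, 0, by simp [emb3]⟩
  | add p q hp hq =>
    obtain ⟨A, B, r, h⟩ := hp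
    obtain ⟨A', B', r', h'⟩ := hq
    refine ⟨A + A', B + B', r + r', ?_⟩
    rw [map_add, map_add, h, h']
    ring
  | mul_X p i hp =>
    obtain ⟨A, B, r, h⟩ := hp
    have h0 : emb3 (X 0) = X 0 := by simp [emb3]
    have h1 : emb3 (X 1) = X 1 := by simp [emb3]
    have h2 : emb3 (X 2) = X 3 := by simp [emb3]
    have h4 : emb3 4 = 4 := map_ofNat emb3 4
    have key : ∃ (A' B' : MvPolynomial (Fin 3) ℤ) (s : MvPolynomial (Fin 4) ℤ),
      (emb3 A + X 2 * emb3 B) * X i =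
        emb3 A' + X 2 * emb3 B' + s * (X 2 ^ 2 - 4 * X 3 - X 0 * X 1) := by
      fin_cases i
      · exact ⟨A * X 0, B * X 0, 0, by simp only [map_mul, h0]; simp; ring⟩
      · exact ⟨A * X 1, B * X 1, 0, by simp only [map_mul, h1]; simp; ring⟩
      · refine ⟨(4 * X 2 + X 0 * X 1) * B, A, emb3 B, ?_⟩
        simp only [map_mul, map_add, h0, h1, h2, h4]
        simp
        ring
      · exact ⟨A * X 2, B * X 2, 0, by simp only [map_mul, h2]; simp; ring⟩
    obtain ⟨A', B', s, hs⟩ := key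
    refine ⟨A', B', s + r * X i, ?_⟩
    rw [h]
    linear_combination hs

lemma aeval_ψ (b c u : ℂ) (p : MvPolynomial (Fin 4) ℤ) :
    aeval ![b, c, u] (ψ p) =
      aeval ![b ^ 2, c ^ 2, 2 * u - b * c, u ^ 2 - b * c * u] p := by
  have : (aeval ![b, c, u]).comp ψ =
      (aeval ![b ^ 2, c ^ 2, 2 * u - b * c, u ^ 2 - b * c * u] :
        MvPolynomial (Fin 4) ℤ →ₐ[ℤ] ℂ) := by
    ext i
    fin_cases i <;> simp [ψ]
  exact DFunLike.congr_fun this p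

lemma aeval_emb3 (w x y z : ℂ) (p : MvPolynomial (Fin 3) ℤ) :
    aeval ![w, x, y, z] (emb3 p) = aeval ![w, x, z] p := by
  have : (aeval ![w, x, y, z]).comp emb3 =
      (aeval ![w, x, z] : MvPolynomial (Fin 3) ℤ →ₐ[ℤ] ℂ) := by
    ext i
    fin_cases i <;> simp [emb3]
  exact DFunLike.congr_fun this p

lemma eq_zero_of_aeval (p : MvPolynomial (Fin 3) ℤ)
    (h : ∀ w x z : ℂ, aeval ![w, x, z] p = 0) : p = 0 := by
  apply MvPolynomial.map_injective (Int.castRingHom ℂ) Int.cast_injective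
  rw [map_zero]
  apply MvPolynomial.funext
  intro v
  have hv : v = ![v 0, v 1, v 2] := by
    ext i
    fin_cases i <;> rfl
  rw [hv, map_zero, MvPolynomial.eval_map]
  exact h _ _ _

lemma pointwise (A B : MvPolynomial (Fin 3) ℤ) (h : ψ (emb3 A + X 2 * emb3 B) = 0)
    (w x z : ℂ) : aeval ![w, x, z] A = 0 ∧ (4 * z + w * x) * aeval ![w, x, z] B = 0 := by
  obtain ⟨b, hb⟩ := IsAlgClosed.exists_pow_nat_eq w (n := 2) (by norm_num)
  obtain ⟨c, hc⟩ := IsAlgClosed.exists_pow_nat_eq x (n := 2) (by norm_num)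
  obtain ⟨d, hd⟩ := IsAlgClosed.exists_pow_nat_eq (4 * z + w * x) (n := 2) (by norm_num)
  have key : ∀ e : ℂ, e ^ 2 = 4 * z + w * x →
      aeval ![w, x, z] A + e * aeval ![w, x, z] B = 0 := by
    intro e he
    have h1 := aeval_ψ b c ((e + b * c) / 2) (emb3 A + X 2 * emb3 B)
    have e1 : 2 * ((e + b * c) / 2) - b * c = e := by ring
    have e2 : ((e + b * c) / 2) ^ 2 - b * c * ((e + b * c) / 2) = z := by
      rw [← hb, ← hc] at he
      linear_combination he / 4
    rw [h, map_zero, hb, hc, e1, e2, map_add, map_mul, aeval_emb3, aeval_emb3, aeval_X] at h1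
    exact h1.symm
  have k1 := key d hd
  have k2 := key (-d) (by rw [neg_sq, hd])
  constructor
  · linear_combination (k1 + k2) / 2
  · rw [← hd]
    linear_combination d * (k1 - k2) / 2

/-- The kernel of `w ↦ b₁², x ↦ b₂², y ↦ 2u − b₁b₂, z ↦ u² − b₁b₂u` is the principal
ideal generated by `y² − 4z − wx`. -/
theorem ker_psi :
    RingHom.ker (ψ : MvPolynomial (Fin 4) ℤ →+* MvPolynomial (Fin 3) ℤ) =
      Ideal.span {X 2 ^ 2 - 4 * X 3 - X 0 * X 1} := by
  apply le_antisymm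
  · intro p hp
    have hp' : ψ p = 0 := hp
    obtain ⟨A, B, q, rfl⟩ := reduce_mod p
    have hf : ψ (X 2 ^ 2 - 4 * X 3 - X 0 * X 1) = 0 := by
      have h4 : ψ 4 = 4 := map_ofNat ψ 4
      simp only [map_sub, map_mul, map_pow, h4]
      simp [ψ]
      ring
    rw [map_add, map_mul ψ q, hf, mul_zero, add_zero] at hp'
    have hA : A = 0 := eq_zero_of_aeval A fun w x z => (pointwise A B hp' w x z).1
    have hB : (4 * X 2 + X 0 * X 1) * B = 0 := by
      apply eq_zero_of_aeval
      intro w x z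
      have := (pointwise A B hp' w x z).2
      rw [map_mul, map_add, map_mul, map_mul, map_ofNat]
      simpa using this
    have hne : (4 * X 2 + X 0 * X 1 : MvPolynomial (Fin 3) ℤ) ≠ 0 := by
      intro h0
      have := congrArg (MvPolynomial.eval ![1, 1, 1]) h0
      rw [map_add, map_mul, map_mul, map_ofNat] at this
      simp at this
    have hB' : B = 0 := (mul_eq_zero.mp hB).resolve_left hne
    rw [hA, hB', map_zero, mul_zero, zero_add, zero_add]
    exact Ideal.mul_mem_left _ _ (Ideal.subset_span rfl)
  · rw [Ideal.span_singleton_le_iff_mem]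
    change ψ (X 2 ^ 2 - 4 * X 3 - X 0 * X 1) = 0
    have h4 : ψ 4 = 4 := map_ofNat ψ 4
    simp only [map_sub, map_mul, map_pow, h4]
    simp [ψ]
    ring
end
end

section
/- Let k be an algebraically closed field of characteristic different from 2, and let (A₁,B₁,C₁,A₂,B₂,C₂) ∈ k⁶ be the coefficients of two binary quadratic forms s₁ = A₁X²+B₁XY+C₁Y², s₂ = A₂X²+B₂XY+C₂Y². Then Δ₁ = Δ₂ = Γ = 0 (evaluated at these coefficients) if and only if there exist α, β, λ, μ ∈ k with s₁ = λ(αX+βY)² and s₂ = μ(αX+βY)². (Since in characteristic ≠ 2 the invariant ring is generated by Δ₁, Δ₂, Γ, this says a geometric point of ℙV is not semistable exactly when both sections are multiples of the square of a common linear form.) -/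
open MvPolynomial

lemma quad_eq_iff_aux {k : Type*} [Field k] (a b c l α β : k) :
    (C a * X 0 ^ 2 + C b * X 0 * X 1 + C c * X 1 ^ 2 : MvPolynomial (Fin 2) k) =
      C l * (C α * X 0 + C β * X 1) ^ 2 ↔
    a = l * α ^ 2 ∧ b = 2 * l * α * β ∧ c = l * β ^ 2 := by
  constructor
  · intro h
    have h1 := congrArg (eval ![1, 0]) h
    have h2 := congrArg (eval ![0, 1]) h
    have h3 := congrArg (eval ![1, 1]) h
    simp at h1 h2 h3
    refine ⟨h1, ?_, h2⟩
    linear_combination h3 - h1 - h2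
  · rintro ⟨rfl, rfl, rfl⟩
    simp only [map_mul, map_pow, map_ofNat]
    ring

/-- Over an algebraically closed field of characteristic `≠ 2`, a pair of binary quadratic
forms `s₁ = A₁X²+B₁XY+C₁Y²`, `s₂ = A₂X²+B₂XY+C₂Y²` satisfies `Δ₁ = Δ₂ = Γ = 0` if and
only if both forms are scalar multiples of the square of a common linear form, i.e. the
corresponding point of `ℙV` is not semistable. -/
theorem not_semistable_iff_common_square_char_ne_two
    (k : Type*) [Field k] [IsAlgClosed k] (h2 : (2 : k) ≠ 0)
    (A₁ B₁ C₁ A₂ B₂ C₂ : k) :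
    (B₁ ^ 2 - 4 * A₁ * C₁ = 0 ∧ B₂ ^ 2 - 4 * A₂ * C₂ = 0 ∧
        B₁ * B₂ - 2 * A₁ * C₂ - 2 * C₁ * A₂ = 0) ↔
      ∃ α β lam mu : k,
        (C A₁ * X 0 ^ 2 + C B₁ * X 0 * X 1 + C C₁ * X 1 ^ 2 : MvPolynomial (Fin 2) k) =
            C lam * (C α * X 0 + C β * X 1) ^ 2 ∧
        (C A₂ * X 0 ^ 2 + C B₂ * X 0 * X 1 + C C₂ * X 1 ^ 2 : MvPolynomial (Fin 2) k) =
            C mu * (C α * X 0 + C β * X 1) ^ 2 := by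
  simp only [quad_eq_iff_aux]
  constructor
  · rintro ⟨h₁, h₃, h₄⟩
    have h4 : (4 : k) ≠ 0 := by
      have : (4 : k) = 2 * 2 := by norm_num
      rw [this]; exact mul_ne_zero h2 h2
    by_cases hA : A₁ = 0
    · subst hA
      have hB : B₁ = 0 := by
        apply pow_eq_zero_iff (two_ne_zero) |>.1
        linear_combination h₁
      subst hB
      by_cases hC : C₁ = 0
      · subst hC
        by_cases hA2 : A₂ = 0
        · subst hA2
          have hB : B₂ = 0 := by
            apply pow_eq_zero_iff (two_ne_zero) |>.1
            linear_combination h₃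
          subst hB
          exact ⟨0, 1, 0, C₂, by simp, by simp⟩
        · refine ⟨2 * A₂, B₂, 0, 1 / (4 * A₂), by simp, ?_, ?_, ?_⟩
          · field_simp; ring
          · field_simp; ring
          · field_simp; linear_combination -h₃
      · have hA2 : A₂ = 0 := by
          have : (2 * C₁) * A₂ = 0 := by linear_combination -h₄
          exact (mul_eq_zero.1 this).resolve_left (mul_ne_zero h2 hC)
        subst hA2
        have hB : B₂ = 0 := by
          apply pow_eq_zero_iff (two_ne_zero) |>.1
          linear_combination h₃
        subst hB
        exact ⟨0, 1, C₁, C₂, by simp, by simp⟩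
    · have e1 : A₁ * B₂ - A₂ * B₁ = 0 := by
        apply pow_eq_zero_iff (two_ne_zero) |>.1
        linear_combination A₁ ^ 2 * h₃ + A₂ ^ 2 * h₁ - 2 * A₁ * A₂ * h₄
      have e2 : A₁ * C₂ - A₂ * C₁ = 0 := by
        have : (2 * A₁) * (A₁ * C₂ - A₂ * C₁) = 0 := by
          linear_combination B₁ * e1 + A₂ * h₁ - A₁ * h₄
        exact (mul_eq_zero.1 this).resolve_left (mul_ne_zero h2 hA)
      refine ⟨2 * A₁, B₁, 1 / (4 * A₁), A₂ / (4 * A₁ ^ 2), ⟨?_, ?_, ?_⟩, ?_, ?_, ?_⟩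
      · field_simp; ring
      · field_simp; ring
      · field_simp; linear_combination -h₁
      · field_simp; ring
      · field_simp; linear_combination 4 * e1
      · field_simp; linear_combination 4 * A₁ * e2 - A₂ * h₁
  · rintro ⟨α, β, l, m, ⟨rfl, rfl, rfl⟩, rfl, rfl, rfl⟩
    refine ⟨?_, ?_, ?_⟩ <;> ring
end

section
/- Let k be an algebraically closed field of characteristic 2, and let (A₁,B₁,C₁,A₂,B₂,C₂) ∈ k⁶ be the coefficients of two binary quadratic forms s₁ = A₁X²+B₁XY+C₁Y², s₂ = A₂X²+B₂XY+C₂Y². Then B₁ = B₂ = 0 and Λ = 0 (evaluated at these coefficients) if and only if there exist α, β, λ, μ ∈ k with s₁ = λ(αX+βY)² and s₂ = μ(αX+βY)². (Since in characteristic 2 the invariant ring is generated by B₁, B₂, Λ, this says a geometric point of ℙV is not semistable exactly when both sections are multiples of the square of a common linear form.) -/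
open MvPolynomial

theorem form_eq_iff_aux (k : Type*) [Field k] [CharP k 2] (a b c α β l : k) :
    (C a * X 0 ^ 2 + C b * X 0 * X 1 + C c * X 1 ^ 2 : MvPolynomial (Fin 2) k) =
      C l * (C α * X 0 + C β * X 1) ^ 2 ↔ a = l * α ^ 2 ∧ b = 0 ∧ c = l * β ^ 2 := by
  have h2 : (2 : k) = 0 := CharTwo.two_eq_zero
  constructor
  · intro h
    have e1 := congrArg (eval ![1, 0]) h
    have e2 := congrArg (eval ![0, 1]) h
    have e3 := congrArg (eval ![1, 1]) h
    simp at e1 e2 e3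
    refine ⟨e1, ?_, e2⟩
    linear_combination e3 - e1 - e2 + l * α * β * h2
  · rintro ⟨rfl, rfl, rfl⟩
    have h2' : (2 : MvPolynomial (Fin 2) k) = 0 := CharTwo.two_eq_zero
    simp only [C_mul, C_pow, C_0]
    linear_combination (-(C l * C α * C β * X 0 * X 1)) * h2'

/-- Over an algebraically closed field of characteristic `2`, a pair of binary quadratic
forms `s₁ = A₁X²+B₁XY+C₁Y²`, `s₂ = A₂X²+B₂XY+C₂Y²` satisfies `B₁ = B₂ = 0` and `Λ = 0`
(with `Λ = (A₁C₂+C₁A₂)² + (A₁C₂+C₁A₂)B₁B₂ + A₁C₁B₂² + A₂C₂B₁²` the characteristic-2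
reduction of the integral invariant) if and only if both forms are scalar multiples of the
square of a common linear form, i.e. the corresponding point of `ℙV` is not semistable. -/
theorem not_semistable_iff_common_square_char_two
    (k : Type*) [Field k] [IsAlgClosed k] [CharP k 2]
    (A₁ B₁ C₁ A₂ B₂ C₂ : k) :
    (B₁ = 0 ∧ B₂ = 0 ∧
        (A₁ * C₂ + C₁ * A₂) ^ 2 + (A₁ * C₂ + C₁ * A₂) * (B₁ * B₂)
          + A₁ * C₁ * B₂ ^ 2 + A₂ * C₂ * B₁ ^ 2 = 0) ↔
      ∃ α β lam mu : k,
        (C A₁ * X 0 ^ 2 + C B₁ * X 0 * X 1 + C C₁ * X 1 ^ 2 : MvPolynomial (Fin 2) k) =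
            C lam * (C α * X 0 + C β * X 1) ^ 2 ∧
        (C A₂ * X 0 ^ 2 + C B₂ * X 0 * X 1 + C C₂ * X 1 ^ 2 : MvPolynomial (Fin 2) k) =
            C mu * (C α * X 0 + C β * X 1) ^ 2 := by
  have h2 : (2 : k) = 0 := CharTwo.two_eq_zero
  simp only [form_eq_iff_aux]
  constructor
  · rintro ⟨rfl, rfl, h⟩
    have h0 : A₁ * C₂ + C₁ * A₂ = 0 := by
      apply pow_eq_zero_iff (two_ne_zero) |>.mp
      linear_combination h
    obtain ⟨a₁, rfl⟩ := IsAlgClosed.exists_pow_nat_eq A₁ (n := 2) (by norm_num)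
    obtain ⟨c₁, rfl⟩ := IsAlgClosed.exists_pow_nat_eq C₁ (n := 2) (by norm_num)
    by_cases ha : a₁ = 0
    · by_cases hc : c₁ = 0
      · obtain ⟨a₂, rfl⟩ := IsAlgClosed.exists_pow_nat_eq A₂ (n := 2) (by norm_num)
        obtain ⟨c₂, rfl⟩ := IsAlgClosed.exists_pow_nat_eq C₂ (n := 2) (by norm_num)
        exact ⟨a₂, c₂, 0, 1, by simp [ha, hc]⟩
      · refine ⟨a₁, c₁, 1, C₂ / c₁ ^ 2, by simp, ?_, rfl, ?_⟩
        · field_simp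
          linear_combination h0 - C₂ * a₁ ^ 2 * h2
        · field_simp
    · refine ⟨a₁, c₁, 1, A₂ / a₁ ^ 2, by simp, ?_, rfl, ?_⟩
      · field_simp
      · field_simp
        linear_combination h0 - A₂ * c₁ ^ 2 * h2
  · rintro ⟨α, β, l, m, ⟨rfl, rfl, rfl⟩, rfl, rfl, rfl⟩
    refine ⟨rfl, rfl, ?_⟩
    linear_combination 2 * (l * m * α ^ 2 * β ^ 2) ^ 2 * h2
end

section
/- Let φ: A → B be a flat local homomorphism of noetherian local rings and let f ∈ B. Then the following are equivalent: (i) f is a nonzerodivisor in B and B/(f) is flat over A; (ii) the image of f in B ⊗_A A/𝔪_A = B/𝔪_A B is a nonzerodivisor, where 𝔪_A is the maximal ideal of A. -/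
theorem lcf_aux_mem {A B : Type*} [CommRing A] [CommRing B] [Algebra A B] {l : ℕ}
    (a : Fin l → A) {b : B} (hb : b ∈ (Ideal.span (Set.range a)).map (algebraMap A B)) :
    ∃ z : Fin l → B, b = ∑ i, a i • z i := by
  rw [Ideal.map_span, ← Set.range_comp, Ideal.mem_span_range_iff_exists_fun] at hb
  obtain ⟨c, hc⟩ := hb
  refine ⟨c, ?_⟩
  rw [← hc]
  exact Finset.sum_congr rfl fun i _ => by simp [Algebra.smul_def, mul_comm]

theorem lcf_aux_mem' {A B : Type*} [CommRing A] [CommRing B] [Algebra A B] [IsNoetherianRing A]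
    (I : Ideal A) {b : B} (hb : b ∈ I.map (algebraMap A B)) :
    ∃ (l : ℕ) (a : Fin l → A) (z : Fin l → B), (∀ i, a i ∈ I) ∧ b = ∑ i, a i • z i := by
  obtain ⟨l, a, ha⟩ := Submodule.fg_iff_exists_fin_generating_family.mp
    (IsNoetherian.noetherian I)
  have ha' : Ideal.span (Set.range a) = I := ha
  rw [← ha'] at hb
  obtain ⟨z, hz⟩ := lcf_aux_mem a hb
  exact ⟨l, a, z, fun i => ha' ▸ Ideal.subset_span ⟨i, rfl⟩, hz⟩

theorem lcf_sum_mem {A B : Type*} [CommRing A] [CommRing B] [Algebra A B] {ι : Type*} [Fintype ι]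
    (I : Ideal A) (a : ι → A) (z : ι → B) (ha : ∀ i, a i ∈ I) :
    ∑ i, a i • z i ∈ I.map (algebraMap A B) :=
  Ideal.sum_mem _ fun i _ => by
    rw [Algebra.smul_def]
    exact Ideal.mul_mem_right _ _ (Ideal.mem_map_of_mem _ (ha i))

theorem lcf_colon {A B : Type*} [CommRing A] [CommRing B] [Algebra A B] [IsNoetherianRing A]
    [Module.Flat A B] (J K : Ideal A) (a : A) (hK : ∀ c, a * c ∈ J → c ∈ K) (x : B)
    (hx : a • x ∈ J.map (algebraMap A B)) : x ∈ K.map (algebraMap A B) := by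
  obtain ⟨l, g, z, hg, hz⟩ := lcf_aux_mem' J hx
  have h0 : ∑ i : Option (Fin l), (Option.elim i a (fun i => - g i)) •
      (Option.elim i x z) = 0 := by
    simp [Fintype.sum_option, hz]
  obtain ⟨k, c, y, h1, h2⟩ := Module.Flat.isTrivialRelation_of_sum_smul_eq_zero (R := A) (M := B) h0
  have hx' := h1 none
  simp only [Option.elim_none] at hx'
  rw [hx']
  refine lcf_sum_mem _ _ _ fun j => hK _ ?_
  have := h2 j
  simp only [Fintype.sum_option, Option.elim_none, Option.elim_some] at this
  rw [eq_neg_of_add_eq_zero_left this]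
  exact neg_mem (Ideal.sum_mem _ fun i _ => Ideal.mul_mem_right _ _ (neg_mem (hg i)))

theorem lcf_prim {A B : Type*} [CommRing A] [CommRing B]
    [IsNoetherianRing A] [IsLocalRing A] [Algebra A B] [Module.Flat A B] (f : B)
    (hf : ∀ b, f * b ∈ (IsLocalRing.maximalIdeal A).map (algebraMap A B) →
      b ∈ (IsLocalRing.maximalIdeal A).map (algebraMap A B)) (J : Ideal A) :
    (∃ n, IsLocalRing.maximalIdeal A ^ n ≤ J) →
    ∀ b, f * b ∈ J.map (algebraMap A B) → b ∈ J.map (algebraMap A B) := by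
  classical
  induction J using IsNoetherian.induction with
  | hgt J ih =>
  intro hn b hb
  by_cases hJ : J = ⊤
  · subst hJ; rw [Ideal.map_top]; trivial
  have hle := Nat.find_spec hn
  obtain ⟨n, hn'⟩ : ∃ n, Nat.find hn = n + 1 := by
    refine Nat.exists_eq_succ_of_ne_zero fun h => hJ ?_
    rw [h] at hle
    simpa using hle
  rw [hn'] at hle
  have hmin := Nat.find_min hn (m := n) (by omega)
  obtain ⟨a, ha, haJ⟩ := SetLike.not_le_iff_exists.mp hmin
  have ham : ∀ c ∈ IsLocalRing.maximalIdeal A, a * c ∈ J := fun c hc =>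
    hle (by rw [pow_succ]; exact Ideal.mul_mem_mul ha hc)
  have hcol : ∀ c, a * c ∈ J → c ∈ IsLocalRing.maximalIdeal A := by
    intro c hc
    rw [IsLocalRing.mem_maximalIdeal]
    intro hu
    exact haJ ((Ideal.mul_unit_mem_iff_mem J hu).mp hc)
  have hlt : J < J ⊔ Ideal.span {a} := by
    refine lt_of_le_of_ne le_sup_left fun h => haJ ?_
    rw [h]
    exact Ideal.mem_sup_right (Ideal.mem_span_singleton_self a)
  have hb' := ih _ hlt ⟨n + 1, hle.trans hlt.le⟩ b (Ideal.map_mono hlt.le hb)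
  rw [Ideal.map_sup, Ideal.map_span, Set.image_singleton] at hb'
  obtain ⟨u, hu, v, hv, rfl⟩ := Submodule.mem_sup.mp hb'
  obtain ⟨c, rfl⟩ := Ideal.mem_span_singleton'.mp hv
  refine add_mem hu ?_
  have h1 : a • (f * c) ∈ Ideal.map (algebraMap A B) J := by
    have : a • (f * c) = f * (u + c * algebraMap A B a) - f * u := by
      rw [Algebra.smul_def]; ring
    rw [this]
    exact sub_mem hb (Ideal.mul_mem_left _ _ hu)
  have h2 := hf c (lcf_colon J _ a hcol _ h1)
  obtain ⟨l, g, z, hg, rfl⟩ := lcf_aux_mem' _ h2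
  have : (∑ i, g i • z i) * algebraMap A B a = ∑ i, (a * g i) • z i := by
    rw [mul_comm, ← Algebra.smul_def, Finset.smul_sum]
    simp [mul_smul]
  rw [this]
  exact lcf_sum_mem _ _ _ fun i => ham _ (hg i)

theorem lcf_all {A B : Type*} [CommRing A] [CommRing B]
    [IsNoetherianRing A] [IsNoetherianRing B] [IsLocalRing A] [IsLocalRing B]
    [Algebra A B] [IsLocalHom (algebraMap A B)] [Module.Flat A B] (f : B)
    (hf : ∀ b, f * b ∈ (IsLocalRing.maximalIdeal A).map (algebraMap A B) →
      b ∈ (IsLocalRing.maximalIdeal A).map (algebraMap A B)) (I : Ideal A)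
    (b : B) (hb : f * b ∈ I.map (algebraMap A B)) : b ∈ I.map (algebraMap A B) := by
  have hK := Ideal.iInf_pow_smul_eq_bot_of_isLocalRing (M := B ⧸ I.map (algebraMap A B))
    _ (IsLocalRing.map_maximalIdeal_lt_top (algebraMap A B)).ne
  rw [← Ideal.Quotient.eq_zero_iff_mem, ← Submodule.mem_bot B, ← hK, Submodule.mem_iInf]
  intro n
  have h := lcf_prim f hf (I ⊔ IsLocalRing.maximalIdeal A ^ n) ⟨n, le_sup_right⟩ b
    (Ideal.map_mono le_sup_left hb)
  rw [Ideal.map_sup, Ideal.map_pow] at h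
  obtain ⟨u, hu, v, hv, rfl⟩ := Submodule.mem_sup.mp h
  have : Ideal.Quotient.mk (I.map (algebraMap A B)) (u + v) =
      v • (1 : B ⧸ I.map (algebraMap A B)) := by
    rw [map_add, Ideal.Quotient.eq_zero_iff_mem.mpr hu, zero_add, Algebra.smul_def, mul_one]
    rfl
  rw [this]
  exact Submodule.smul_mem_smul hv trivial


/-- Local criterion for flatness used for slicing groupoids: given a flat local
homomorphism `A → B` of noetherian local rings and `f ∈ B`, the element `f` is a
nonzerodivisor with `B/(f)` flat over `A` if and only if the image of `f` in
`B ⊗_A A/𝔪_A = B/𝔪_A B` is a nonzerodivisor. -/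
theorem local_criterion_for_flatness
    {A B : Type*} [CommRing A] [CommRing B]
    [IsNoetherianRing A] [IsNoetherianRing B]
    [IsLocalRing A] [IsLocalRing B]
    [Algebra A B] [IsLocalHom (algebraMap A B)]
    [Module.Flat A B] (f : B) :
    (f ∈ nonZeroDivisors B ∧ Module.Flat A (B ⧸ Ideal.span {f})) ↔
      Ideal.Quotient.mk (Ideal.map (algebraMap A B) (IsLocalRing.maximalIdeal A)) f ∈
        nonZeroDivisors (B ⧸ Ideal.map (algebraMap A B) (IsLocalRing.maximalIdeal A)) := by
  have key : Ideal.Quotient.mk (Ideal.map (algebraMap A B) (IsLocalRing.maximalIdeal A)) f ∈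
        nonZeroDivisors (B ⧸ Ideal.map (algebraMap A B) (IsLocalRing.maximalIdeal A)) ↔
      ∀ b, f * b ∈ (IsLocalRing.maximalIdeal A).map (algebraMap A B) →
      b ∈ (IsLocalRing.maximalIdeal A).map (algebraMap A B) := by
    rw [mem_nonZeroDivisors_iff_right, Ideal.Quotient.mk_surjective.forall]
    refine forall_congr' fun b => ?_
    rw [← map_mul, Ideal.Quotient.eq_zero_iff_mem, Ideal.Quotient.eq_zero_iff_mem, mul_comm]
  rw [key]
  constructor
  · rintro ⟨hf, hflat⟩ b hb
    obtain ⟨l, a, x, ha, hx⟩ := lcf_aux_mem' _ hb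
    have h0 : ∑ i, a i • (Ideal.Quotient.mk (Ideal.span {f}) (x i)) = 0 := by
      have : Ideal.Quotient.mk (Ideal.span {f}) (f * b) = 0 :=
        Ideal.Quotient.eq_zero_iff_mem.mpr
          (Ideal.mul_mem_right _ _ (Ideal.mem_span_singleton_self f))
      rw [hx, map_sum] at this
      exact this
    obtain ⟨k, c, y, h1, h2⟩ := Module.Flat.isTrivialRelation_of_sum_smul_eq_zero (R := A) (M := B ⧸ Ideal.span {f}) h0
    choose Y hY using fun j => Ideal.Quotient.mk_surjective (y j)
    have h3 : ∀ i, ∃ z, x i = ∑ j, c i j • Y j + f * z := by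
      intro i
      have : Ideal.Quotient.mk (Ideal.span {f}) (x i) =
          Ideal.Quotient.mk (Ideal.span {f}) (∑ j, c i j • Y j) := by
        refine (h1 i).trans ?_; rw [map_sum]
        exact Finset.sum_congr rfl fun j _ => by rw [← hY j]; rfl
      obtain ⟨z, hz⟩ := Ideal.mem_span_singleton'.mp (Ideal.Quotient.eq.mp this)
      exact ⟨z, by rw [mul_comm, hz]; ring⟩
    choose z hz using h3
    have h4 : f * b = f * ∑ i, a i • z i := by
      rw [hx]
      simp_rw [hz, smul_add, Finset.sum_add_distrib, Finset.smul_sum, smul_smul]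
      rw [Finset.sum_comm]
      simp_rw [← Finset.sum_smul, h2]
      simp [Finset.mul_sum]
    have h5 : b = ∑ i, a i • z i := (mul_cancel_left_mem_nonZeroDivisors hf).mp h4
    rw [h5]
    exact lcf_sum_mem _ _ _ ha
  · intro hf
    have H := lcf_all f hf
    refine ⟨?_, ?_⟩
    · rw [mem_nonZeroDivisors_iff_right]
      intro b hb
      have := H ⊥ b (by rw [mul_comm, hb]; exact zero_mem _)
      simpa using this
    · refine Module.Flat.of_forall_isTrivialRelation ?_
      intro l a x hx
      choose X hX using fun i => Ideal.Quotient.mk_surjective (x i)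
      have h0 : Ideal.Quotient.mk (Ideal.span {f}) (∑ i, a i • X i) = 0 := by
        rw [map_sum, ← hx]
        exact Finset.sum_congr rfl fun i _ => by rw [← hX i]; rfl
      obtain ⟨b, hb⟩ := Ideal.mem_span_singleton'.mp (Ideal.Quotient.eq_zero_iff_mem.mp h0)
      have hbm := H (Ideal.span (Set.range a)) b (by
        rw [mul_comm, hb]
        exact lcf_sum_mem _ _ _ fun i => Ideal.subset_span ⟨i, rfl⟩)
      obtain ⟨z, hz⟩ := lcf_aux_mem a hbm
      have h1 : ∑ i, a i • (X i - f * z i) = 0 := by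
        simp_rw [smul_sub, Finset.sum_sub_distrib, ← hb, hz, Finset.sum_mul]
        simp [mul_comm]
      obtain ⟨k, c, y, h2, h3⟩ := Module.Flat.isTrivialRelation_of_sum_smul_eq_zero (R := A) (M := B) h1
      refine ⟨k, c, fun j => Ideal.Quotient.mk _ (y j), fun i => ?_, h3⟩
      have h4 : Ideal.Quotient.mk (Ideal.span {f}) (X i) =
          Ideal.Quotient.mk (Ideal.span {f}) (∑ j, c i j • y j) := by
        rw [Ideal.Quotient.eq, ← h2 i, sub_sub_cancel]
        exact Ideal.mul_mem_right _ _ (Ideal.mem_span_singleton_self f)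
      rw [← hX i, h4, map_sum]
      rfl
end
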